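/- Let α be a real number and 0 < δ < 1 be such that q·‖αq‖ ≥ δ for every positive integer q. Then the series Σ_{x=2}^{∞} 1/(‖αx‖·x·(log₂ x)²), summed over integers x ≥ 2 up to Q, grows at most like a constant times log₂ log₂ Q: explicitly, for every integer Q > 2, Σ_{x=2}^{Q−1} 1/(‖αx‖·x·(log₂ x)²) ≤ 2⁸·δ⁻¹·( log₂ log₂ Q + log₂(1/δ) ). -/

import Mathlib

/-- Distance from a real number to the nearest integer. -/
noncomputable def nint (t : ℝ) : ℝ := |t - round t|

theorem nint_le_abs_sub_int (t : ℝ) (m : ℤ) : nint t ≤ |t - m| :=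
  round_le t m

/-- A sum of `1 / (f x + 1)` over at most `N` elements with distinct values of `f` is bounded by
a harmonic sum. -/
theorem sum_inv_add_one_le {ι : Type*} (T : Finset ι) (f : ι → ℕ) (hf : Set.InjOn f T)
    (N : ℕ) (hN : 0 < N) (hT : T.card ≤ N) :
    ∑ x ∈ T, ((f x : ℝ) + 1)⁻¹ ≤ 2 + Real.log N := by
  classical
  have hN' : (0 : ℝ) < N := by exact_mod_cast hN
  have hsmall : ∑ x ∈ T with f x < N, ((f x : ℝ) + 1)⁻¹ ≤ 1 + Real.log N := by
    have hinj : Set.InjOn f ((T.filter fun x => f x < N : Finset ι) : Set ι) :=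
      hf.mono (by intro x hx; simp at hx; exact hx.1)
    rw [← Finset.sum_image (f := fun n : ℕ => ((n : ℝ) + 1)⁻¹) hinj]
    calc _ ≤ ∑ n ∈ Finset.range N, ((n : ℝ) + 1)⁻¹ := by
          refine Finset.sum_le_sum_of_subset_of_nonneg ?_ fun _ _ _ => by positivity
          intro n hn
          obtain ⟨x, hx, rfl⟩ := Finset.mem_image.1 hn
          exact Finset.mem_range.2 (Finset.mem_filter.1 hx).2
      _ = (harmonic N : ℝ) := by simp [harmonic]
      _ ≤ _ := harmonic_le_one_add_log N
  have hlarge : ∑ x ∈ T with ¬ f x < N, ((f x : ℝ) + 1)⁻¹ ≤ 1 := by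
    calc _ ≤ ∑ x ∈ T with ¬ f x < N, (N : ℝ)⁻¹ := by
          refine Finset.sum_le_sum fun x hx => ?_
          have h : (N : ℝ) ≤ f x := by exact_mod_cast not_lt.1 (Finset.mem_filter.1 hx).2
          exact inv_anti₀ hN' (by linarith)
      _ ≤ N * (N : ℝ)⁻¹ := by
          rw [Finset.sum_const, nsmul_eq_mul]
          have h : ((T.filter fun x => ¬ f x < N).card : ℝ) ≤ N := by
            exact_mod_cast (Finset.card_filter_le _ _).trans hT
          gcongr
      _ = 1 := mul_inv_cancel₀ hN'.ne'
  rw [← Finset.sum_filter_add_sum_filter_not T fun x => f x < N]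
  linarith

section BadlyApproximable

variable {α δ : ℝ}

/-- Fractional parts of the same sign, at points less than `N` apart, have distinct
integer parts after scaling by `N / δ`. -/
theorem injOn_floor_nint (hδ0 : 0 < δ)
    (hbad : ∀ n : ℕ, 0 < n → δ ≤ (n : ℝ) * nint (α * n)) (N : ℕ) (T : Finset ℕ)
    (hT : T ⊆ Finset.Ico N (2 * N))
    (hsign : ∀ x ∈ T, ∀ y ∈ T, |nint (α * x) - nint (α * y)|
      = |(α * x - round (α * x)) - (α * y - round (α * y))|) :
    Set.InjOn (fun x : ℕ => ⌊nint (α * x) * N / δ⌋₊) T := by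
  have key : ∀ x ∈ T, ∀ y ∈ T, x < y →
      ⌊nint (α * x) * N / δ⌋₊ ≠ ⌊nint (α * y) * N / δ⌋₊ := by
    intro x hx y hy hxy heq
    have hx' := Finset.mem_Ico.1 (hT hx)
    have hy' := Finset.mem_Ico.1 (hT hy)
    have hN : (0 : ℝ) < N := by
      have : 0 < N := by omega
      exact_mod_cast this
    have hb := hbad (y - x) (by omega)
    have hd : ((y - x : ℕ) : ℝ) = y - x := by push_cast [hxy.le]; ring
    have hdN : (y : ℝ) - x < N := by
      rw [← hd]; exact_mod_cast (by omega : y - x < N)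
    have hdpos : (0 : ℝ) < (y : ℝ) - x := sub_pos.2 (by exact_mod_cast hxy)
    rw [hd] at hb
    have hn : nint (α * (y - x)) ≤ |nint (α * y) - nint (α * x)| := by
      rw [hsign y hy x hx]
      refine (nint_le_abs_sub_int _ (round (α * y) - round (α * x))).trans (le_of_eq ?_)
      push_cast; congr 1; ring
    have hsep : δ < N * |nint (α * y) - nint (α * x)| := by
      have h0 : 0 < nint (α * (y - x)) := by
        by_contra! h
        nlinarith
      calc δ ≤ _ := hb
        _ < N * nint (α * (y - x)) := by gcongr
        _ ≤ _ := by gcongr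
    have h1 : ∀ z : ℕ, 0 ≤ nint (α * z) * N / δ := fun z => by
      have : 0 ≤ nint (α * z) := abs_nonneg _
      positivity
    have hlt : |nint (α * y) * N / δ - nint (α * x) * N / δ| < 1 := by
      rw [abs_lt]
      have a1 := Nat.floor_le (h1 x)
      have a2 := Nat.lt_floor_add_one (nint (α * x) * N / δ)
      have b1 := Nat.floor_le (h1 y)
      have b2 := Nat.lt_floor_add_one (nint (α * y) * N / δ)
      rw [heq] at a1 a2
      constructor <;> linarith
    have hfac : nint (α * y) * N / δ - nint (α * x) * N / δ
        = (nint (α * y) - nint (α * x)) * (N / δ) := by ring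
    rw [hfac, abs_mul, abs_of_pos (div_pos hN hδ0), ← mul_div_assoc, div_lt_one hδ0] at hlt
    linarith
  intro x hx y hy heq
  rcases lt_trichotomy x y with h | h | h
  · exact (key x hx y hy h heq).elim
  · exact h
  · exact (key y hy x hx h heq.symm).elim

theorem sum_inv_nint_le_of_sign (hδ0 : 0 < δ)
    (hbad : ∀ n : ℕ, 0 < n → δ ≤ (n : ℝ) * nint (α * n)) (N : ℕ) (hN : 0 < N) (T : Finset ℕ)
    (hT : T ⊆ Finset.Ico N (2 * N))
    (hsign : ∀ x ∈ T, ∀ y ∈ T, |nint (α * x) - nint (α * y)|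
      = |(α * x - round (α * x)) - (α * y - round (α * y))|) :
    ∑ x ∈ T, (nint (α * x))⁻¹ ≤ 2 * N / δ * (2 + Real.log N) := by
  have hN' : (0 : ℝ) < N := by exact_mod_cast hN
  have hcard : T.card ≤ N := by
    have := Finset.card_le_card hT
    simp at this
    omega
  calc ∑ x ∈ T, (nint (α * x))⁻¹
      ≤ ∑ x ∈ T, 2 * N / δ * ((⌊nint (α * x) * N / δ⌋₊ : ℝ) + 1)⁻¹ := by
        refine Finset.sum_le_sum fun x hx => ?_
        have hx' := Finset.mem_Ico.1 (hT hx)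
        have hb := hbad x (by omega)
        have h0 : 0 ≤ nint (α * x) := abs_nonneg _
        have hfl := Nat.floor_le (by positivity : 0 ≤ nint (α * x) * N / δ)
        have hx2 : (x : ℝ) ≤ 2 * N := by exact_mod_cast hx'.2.le
        have hlow : δ ≤ 2 * N * nint (α * x) := hb.trans (by gcongr)
        set n := ⌊nint (α * x) * N / δ⌋₊
        have hmain : ((n : ℝ) + 1) * (δ / (2 * N)) ≤ nint (α * x) := by
          rw [← mul_div_assoc, div_le_iff₀ (by positivity)]
          rw [le_div_iff₀ hδ0] at hfl
          rcases Nat.eq_zero_or_pos n with hn | hn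
          · rw [hn]; push_cast; linarith
          · have : (1 : ℝ) ≤ n := by exact_mod_cast hn
            nlinarith
        calc (nint (α * x))⁻¹ ≤ (((n : ℝ) + 1) * (δ / (2 * N)))⁻¹ :=
              inv_anti₀ (by positivity) hmain
          _ = _ := by rw [mul_inv, inv_div, mul_comm]
    _ = 2 * N / δ * ∑ x ∈ T, ((⌊nint (α * x) * N / δ⌋₊ : ℝ) + 1)⁻¹ := by
        rw [Finset.mul_sum]
    _ ≤ _ := by
        gcongr
        exact sum_inv_add_one_le T _ (injOn_floor_nint hδ0 hbad N T hT hsign) N hN hcard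

theorem sum_Ico_inv_nint_le (hδ0 : 0 < δ)
    (hbad : ∀ n : ℕ, 0 < n → δ ≤ (n : ℝ) * nint (α * n)) (N : ℕ) (hN : 0 < N) :
    ∑ x ∈ Finset.Ico N (2 * N), (nint (α * x))⁻¹ ≤ 4 * N / δ * (2 + Real.log N) := by
  classical
  rw [← Finset.sum_filter_add_sum_filter_not (Finset.Ico N (2 * N))
    fun x : ℕ => 0 ≤ α * x - round (α * x)]
  have hpos := sum_inv_nint_le_of_sign hδ0 hbad N hN
    ((Finset.Ico N (2 * N)).filter fun x : ℕ => 0 ≤ α * x - round (α * x))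
    (Finset.filter_subset _ _) (by
      intro x hx y hy
      rw [nint, nint, abs_of_nonneg (Finset.mem_filter.1 hx).2,
        abs_of_nonneg (Finset.mem_filter.1 hy).2])
  have hneg := sum_inv_nint_le_of_sign hδ0 hbad N hN
    ((Finset.Ico N (2 * N)).filter fun x : ℕ => ¬ 0 ≤ α * x - round (α * x))
    (Finset.filter_subset _ _) (by
      intro x hx y hy
      rw [nint, nint, abs_of_neg (not_le.1 (Finset.mem_filter.1 hx).2),
        abs_of_neg (not_le.1 (Finset.mem_filter.1 hy).2), abs_sub_comm]
      congr 1; ring)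
  calc _ ≤ _ := add_le_add hpos hneg
    _ = _ := by ring

theorem sum_dyadic_block_le (hδ0 : 0 < δ)
    (hbad : ∀ n : ℕ, 0 < n → δ ≤ (n : ℝ) * nint (α * n)) (k : ℕ) (hk : 1 ≤ k) :
    ∑ x ∈ Finset.Ico ((2 : ℕ) ^ k) (2 * 2 ^ k), 1 / (nint (α * x) * x * (Real.logb 2 x) ^ 2)
      ≤ 12 / δ * (k : ℝ)⁻¹ := by
  have hk' : (1 : ℝ) ≤ k := by exact_mod_cast hk
  have hlog : Real.log ((2 ^ k : ℕ) : ℝ) ≤ k := by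
    push_cast
    rw [Real.log_pow]
    nlinarith [Real.log_two_lt_d9]
  calc _ ≤ ∑ x ∈ Finset.Ico ((2 : ℕ) ^ k) (2 * 2 ^ k),
          ((2 : ℝ) ^ k * (k : ℝ) ^ 2)⁻¹ * (nint (α * x))⁻¹ := by
        refine Finset.sum_le_sum fun x hx => ?_
        have hx' := (Finset.mem_Ico.1 hx).1
        have hx2 : (2 : ℝ) ^ k ≤ x := by exact_mod_cast hx'
        have hxpos : 0 < x := lt_of_lt_of_le (by positivity) hx'
        have hb := hbad x hxpos
        have hn : 0 < nint (α * x) := by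
          have : (0 : ℝ) < x := by exact_mod_cast hxpos
          by_contra! h
          nlinarith
        have hlb : (k : ℝ) ≤ Real.logb 2 x := by
          rw [Real.le_logb_iff_rpow_le one_lt_two (by exact_mod_cast hxpos), Real.rpow_natCast]
          exact hx2
        rw [one_div, ← mul_inv]
        apply inv_anti₀ (by positivity)
        calc (2 : ℝ) ^ k * (k : ℝ) ^ 2 * nint (α * x)
            = nint (α * x) * 2 ^ k * (k : ℝ) ^ 2 := by ring
          _ ≤ _ := by gcongr
    _ ≤ ((2 : ℝ) ^ k * (k : ℝ) ^ 2)⁻¹ * (4 * 2 ^ k / δ * (2 + k)) := by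
        rw [← Finset.mul_sum]
        gcongr
        refine (sum_Ico_inv_nint_le hδ0 hbad (2 ^ k) (by positivity)).trans ?_
        push_cast at hlog ⊢
        gcongr
    _ = 4 / δ * (2 + k) / (k : ℝ) ^ 2 := by field_simp
    _ ≤ 4 / δ * (3 * k) / (k : ℝ) ^ 2 := by gcongr; linarith
    _ = _ := by field_simp; norm_num

end BadlyApproximable

theorem partial_sum_loglog_growth
    (α δ : ℝ) (hδ0 : 0 < δ) (hδ1 : δ < 1)
    (hbad : ∀ n : ℕ, 0 < n → δ ≤ (n : ℝ) * nint (α * n)) :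
    ∀ Q : ℕ, 2 < Q →
      ∑ x ∈ Finset.Ico 2 Q, 1 / (nint (α * x) * x * (Real.logb 2 x) ^ 2)
        ≤ 2 ^ 8 * δ⁻¹ * (Real.logb 2 (Real.logb 2 Q) + Real.logb 2 (1 / δ)) := by
  intro Q hQ
  have hhalf : δ ≤ 1 / 2 := by
    have h := hbad 1 one_pos
    have h' : nint (α * (1 : ℕ)) ≤ 1 / 2 := abs_sub_round _
    push_cast at h h'
    linarith
  have hL : 1 ≤ Real.logb 2 (1 / δ) := by
    rw [Real.le_logb_iff_rpow_le one_lt_two (by positivity), Real.rpow_one, le_div_iff₀ hδ0]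
    linarith
  set K := Nat.log 2 Q
  have hK1 : 1 ≤ K := Nat.log_pos one_lt_two hQ.le
  have hK1' : (1 : ℝ) ≤ K := by exact_mod_cast hK1
  have hQpos : (0 : ℝ) < Q := by exact_mod_cast (by omega : 0 < Q)
  have hKQ : (K : ℝ) ≤ Real.logb 2 Q := by
    rw [Real.le_logb_iff_rpow_le one_lt_two hQpos, Real.rpow_natCast]
    exact_mod_cast Nat.pow_log_le_self 2 (by omega)
  have hlogK : Real.log K ≤ Real.logb 2 (Real.logb 2 Q) := by
    calc Real.log K ≤ Real.logb 2 K := by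
          rw [Real.logb, le_div_iff₀ (Real.log_pos one_lt_two)]
          have := Real.log_nonneg hK1'
          nlinarith [Real.log_two_lt_d9]
      _ ≤ _ := Real.logb_le_logb_of_le one_lt_two (by linarith) hKQ
  have hmaps : ∀ x ∈ Finset.Ico 2 Q, Nat.log 2 x ∈ Finset.Icc 1 K := by
    intro x hx
    have hx' := Finset.mem_Ico.1 hx
    exact Finset.mem_Icc.2 ⟨Nat.log_pos one_lt_two hx'.1, Nat.log_mono_right hx'.2.le⟩
  have hsum : ∑ x ∈ Finset.Ico 2 Q, 1 / (nint (α * x) * x * (Real.logb 2 x) ^ 2)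
      ≤ 12 / δ * (1 + Real.log K) := by
    rw [← Finset.sum_fiberwise_of_maps_to hmaps]
    calc _ ≤ ∑ k ∈ Finset.Icc 1 K, 12 / δ * (k : ℝ)⁻¹ := by
          refine Finset.sum_le_sum fun k hk => ?_
          refine le_trans ?_ (sum_dyadic_block_le hδ0 hbad k (Finset.mem_Icc.1 hk).1)
          refine Finset.sum_le_sum_of_subset_of_nonneg ?_ fun x _ _ => ?_
          · intro x hx
            obtain ⟨hmem, rfl⟩ := Finset.mem_filter.1 hx
            have hx' := Finset.mem_Ico.1 hmem
            refine Finset.mem_Ico.2 ⟨Nat.pow_log_le_self 2 (by omega), ?_⟩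
            rw [← pow_succ']
            exact Nat.lt_pow_succ_log_self one_lt_two x
          · have : 0 ≤ nint (α * x) := abs_nonneg _
            positivity
      _ = 12 / δ * (harmonic K : ℝ) := by
          rw [← Finset.mul_sum, harmonic_eq_sum_Icc]
          push_cast
          rfl
      _ ≤ _ := by
          gcongr
          exact harmonic_le_one_add_log K
  have hlogK0 := Real.log_nonneg hK1'
  calc _ ≤ 12 / δ * (1 + Real.log K) := hsum
    _ = 12 * δ⁻¹ * (1 + Real.log K) := by rw [div_eq_mul_inv]
    _ ≤ 2 ^ 8 * δ⁻¹ * (Real.logb 2 (Real.logb 2 Q) + Real.logb 2 (1 / δ)) := by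
        have hle : 1 + Real.log K ≤ Real.logb 2 (Real.logb 2 Q) + Real.logb 2 (1 / δ) := by
          linarith
        exact mul_le_mul (by gcongr; norm_num) hle (by linarith) (by positivity)
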